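/- Let μ₊ and μ₋ be probability measures on a measurable space X, let π ∈ [0,1], let μ = π·μ₊ + (1−π)·μ₋, and let f : X → ℝ be measurable. Then R_PU(f) + R_NU(f) − 1/2 = R_PN(f), where R_PU(f) = ∫∫ l01(f(x), f(x')) dμ(x') dμ₊(x), R_NU(f) = ∫∫ l01(f(x), f(x')) dμ₋(x') dμ(x), and R_PN(f) = ∫∫ l01(f(x), f(x')) dμ₋(x') dμ₊(x). In particular, the semi-supervised PU+NU AUC risk is an unbiased expression of the supervised PN AUC risk without knowledge of the class prior π. -/

import Mathlib

open MeasureTheory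

/-- The zero-one pairwise loss `l01(u,v) = (1 - sign(u - v))/2`, with `sign 0 = 0`. -/
noncomputable def l01 (u v : ℝ) : ℝ := (1 - Real.sign (u - v)) / 2

theorem l01_add_l01_swap (u v : ℝ) : l01 u v + l01 v u = 1 := by
  have h : Real.sign (v - u) = -Real.sign (u - v) := by rw [← Real.sign_neg, neg_sub]
  simp only [l01, h]
  ring

theorem norm_l01_le_one (u v : ℝ) : ‖l01 u v‖ ≤ 1 := by
  rw [Real.norm_eq_abs, abs_le]
  rcases Real.sign_apply_eq (u - v) with h | h | h <;> norm_num [l01, h]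

theorem measurable_l01 : Measurable fun p : ℝ × ℝ => l01 p.1 p.2 := by
  have h : Measurable Real.sign :=
    Measurable.ite measurableSet_Iio measurable_const
      (Measurable.ite measurableSet_Ioi measurable_const measurable_const)
  exact (measurable_const.sub (h.comp (measurable_fst.sub measurable_snd))).div_const 2

section

variable {X : Type*} [MeasurableSpace X] {f : X → ℝ}

theorem integrable_l01_prod (hf : Measurable f) (ν : Measure (X × X)) [IsFiniteMeasure ν] :
    Integrable (fun p : X × X => l01 (f p.1) (f p.2)) ν :=
  .of_bound (measurable_l01.comp
      ((hf.comp measurable_fst).prodMk (hf.comp measurable_snd))).aestronglyMeasurable 1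
    (.of_forall fun _ => norm_l01_le_one _ _)

theorem integrable_l01_right (hf : Measurable f) (ν : Measure X) [IsFiniteMeasure ν] (u : ℝ) :
    Integrable (fun x => l01 u (f x)) ν :=
  .of_bound (measurable_l01.comp (measurable_const.prodMk hf)).aestronglyMeasurable 1
    (.of_forall fun _ => norm_l01_le_one _ _)

/-- The AUC risk of any score for ranking a distribution against itself is `1 / 2`. -/
theorem integral_integral_l01_self (hf : Measurable f) (ν : Measure X) [IsProbabilityMeasure ν] :
    ∫ x, ∫ x', l01 (f x) (f x') ∂ν ∂ν = 1 / 2 := by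
  have hi := integrable_l01_prod hf (ν.prod ν)
  have hs : ∫ p : X × X, l01 (f p.2) (f p.1) ∂ν.prod ν = ∫ p, l01 (f p.1) (f p.2) ∂ν.prod ν :=
    integral_prod_swap fun p : X × X => l01 (f p.1) (f p.2)
  have hadd := integral_add hi hi.swap
  simp only [Function.comp_apply, Prod.fst_swap, Prod.snd_swap, l01_add_l01_swap, hs,
    integral_const, probReal_univ, smul_eq_mul] at hadd
  rw [← integral_prod _ hi]
  linarith

end

/-- The semi-supervised PU+NU AUC risk is an unbiased expression of the supervised
PN AUC risk: `R_PU(f) + R_NU(f) - 1/2 = R_PN(f)`, where the unlabeled marginal is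
`μ = π·μ₊ + (1 - π)·μ₋`. -/
theorem R_PU_add_R_NU_sub_half_eq_R_PN {X : Type*} [MeasurableSpace X]
    (μp μn μ : Measure X) [IsProbabilityMeasure μp] [IsProbabilityMeasure μn]
    (π : ℝ) (hπ0 : 0 ≤ π) (hπ1 : π ≤ 1)
    (hμ : μ = ENNReal.ofReal π • μp + ENNReal.ofReal (1 - π) • μn)
    (f : X → ℝ) (hf : Measurable f) :
    (∫ x, ∫ x', l01 (f x) (f x') ∂μ ∂μp)
      + (∫ x, ∫ x', l01 (f x) (f x') ∂μn ∂μ) - 1 / 2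
      = ∫ x, ∫ x', l01 (f x) (f x') ∂μn ∂μp := by
  have hmix (g : X → ℝ) (hp : Integrable g μp) (hn : Integrable g μn) :
      ∫ x, g x ∂μ = π * ∫ x, g x ∂μp + (1 - π) * ∫ x, g x ∂μn := by
    rw [hμ, integral_add_measure (hp.smul_measure ENNReal.ofReal_ne_top)
      (hn.smul_measure ENNReal.ofReal_ne_top), integral_smul_measure, integral_smul_measure,
      ENNReal.toReal_ofReal hπ0, ENNReal.toReal_ofReal (sub_nonneg.2 hπ1), smul_eq_mul,
      smul_eq_mul]
  have hpp := (integrable_l01_prod hf (μp.prod μp)).integral_prod_left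
  have hpn := (integrable_l01_prod hf (μp.prod μn)).integral_prod_left
  have hnn := (integrable_l01_prod hf (μn.prod μn)).integral_prod_left
  have hPU : ∀ x, ∫ x', l01 (f x) (f x') ∂μ =
      π * ∫ x', l01 (f x) (f x') ∂μp + (1 - π) * ∫ x', l01 (f x) (f x') ∂μn := fun x =>
    hmix _ (integrable_l01_right hf μp _) (integrable_l01_right hf μn _)
  rw [hmix _ hpn hnn]
  simp only [hPU]
  rw [integral_add (hpp.const_mul _) (hpn.const_mul _), integral_const_mul, integral_const_mul,
    integral_integral_l01_self hf, integral_integral_l01_self hf]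
  ring
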